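/- arXiv:1012.0689 — 2 statements merged into one kernel-verified Lean document; each statement's English description precedes it below -/
import Mathlib

section
/- Let p, q ≥ 1 be integers and ε > 0. Then there exists a constant C ≥ 0 such that for every λ ≥ 1 and every r ∈ (0, 3] with λ·r ≤ 6, the integral θ(λ, r) = ∫_r^6 ( sinh s / √(cosh s − cosh r) ) · (D₁^p D₂^q cos(λ·))(s) ds satisfies |θ(λ, r)| ≤ C · λ^{2p+2q−1−ε} · r^{−ε}. -/
/-- The operator `D₁ f(r) = -f'(r) / sinh r`. -/
noncomputable def D1 (f : ℝ → ℝ) : ℝ → ℝ := fun r => -deriv f r / Real.sinh r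

/-- The operator `D₂ f(r) = -f'(r) / sinh(r/2)`. -/
noncomputable def D2 (f : ℝ → ℝ) : ℝ → ℝ := fun r => -deriv f r / Real.sinh (r / 2)
/-- coefficients `1/(2n)!` -/
noncomputable def cF (n : ℕ) : ℝ := 1 / ((2 * n).factorial : ℝ)

/-- The entire function `∑ t^n/(2n)!`, i.e. `cosh √t`. -/
noncomputable def F0 : ℝ → ℝ := (FormalMultilinearSeries.ofScalars ℝ cF).sum

/-- Iterated derivatives of `F0`. -/
noncomputable def Fd : ℕ → ℝ → ℝ
  | 0 => F0
  | (k + 1) => deriv (Fd k)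

lemma cF_radius : (FormalMultilinearSeries.ofScalars ℝ cF).radius = ⊤ := by
  apply FormalMultilinearSeries.ofScalars_radius_eq_top_of_tendsto
  · refine Filter.Eventually.of_forall fun n => ?_
    unfold cF; positivity
  · refine squeeze_zero (g := fun n : ℕ => 1 / ((n : ℝ) + 1)) (fun n => by positivity) ?_
      tendsto_one_div_add_atTop_nhds_zero_nat
    intro n
    have h1 : (2 * n.succ).factorial = (2 * n + 2) * ((2 * n + 1) * (2 * n).factorial) := by
      rw [show 2 * n.succ = (2 * n + 1) + 1 by omega, Nat.factorial_succ, Nat.factorial_succ]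
    have h2 : (0 : ℝ) < ((2 * n).factorial : ℝ) := by positivity
    unfold cF
    rw [h1, Real.norm_of_nonneg (by positivity), Real.norm_of_nonneg (by positivity)]
    push_cast
    rw [div_div, div_le_div_iff₀ (by positivity) (by positivity)]
    have hn : (0 : ℝ) ≤ n := by positivity
    have : 1 / ((2 * (n : ℝ) + 2) * ((2 * n + 1) * (2 * n).factorial)) * 0 = 0 := by ring
    field_simp
    nlinarith

lemma F0_hasSum (t : ℝ) : F0 t = ∑' n : ℕ, cF n * t ^ n := by
  have := FormalMultilinearSeries.ofScalars_sum_eq (E := ℝ) cF t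
  simpa [F0, FormalMultilinearSeries.ofScalarsSum, smul_eq_mul] using this

lemma F0_analytic (t : ℝ) : AnalyticAt ℝ F0 t := by
  have h := (FormalMultilinearSeries.ofScalars ℝ cF).hasFPowerSeriesOnBall
    (by rw [cF_radius]; exact ENNReal.zero_lt_top)
  exact h.analyticAt_of_mem (by rw [cF_radius]; simp)

lemma Fd_analytic (k : ℕ) : ∀ t : ℝ, AnalyticAt ℝ (Fd k) t := by
  induction k with
  | zero => exact F0_analytic
  | succ k ih => exact fun t => (ih t).deriv

lemma Fd_hasDerivAt (k : ℕ) (t : ℝ) : HasDerivAt (Fd k) (Fd (k + 1) t) t :=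
  (Fd_analytic k t).differentiableAt.hasDerivAt

lemma Fd_continuous (k : ℕ) : Continuous (Fd k) :=
  continuous_iff_continuousAt.2 fun t => (Fd_analytic k t).continuousAt

lemma F0_cosh (s : ℝ) : Fd 0 (s ^ 2) = Real.cosh s := by
  rw [← (Real.hasSum_cosh s).tsum_eq]
  simp only [Fd]
  rw [F0_hasSum]
  refine tsum_congr fun n => ?_
  unfold cF
  rw [← pow_mul]; ring

lemma F0_cos (s : ℝ) : Fd 0 (-s ^ 2) = Real.cos s := by
  rw [← (Real.hasSum_cos s).tsum_eq]
  simp only [Fd]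
  rw [F0_hasSum]
  refine tsum_congr fun n => ?_
  unfold cF
  rw [show -s ^ 2 = (-1) * s ^ 2 by ring, mul_pow, ← pow_mul]; ring

lemma Fd_comp (k : ℕ) (s : ℝ) :
    HasDerivAt (fun s => Fd k (s ^ 2)) (Fd (k + 1) (s ^ 2) * (2 * s)) s := by
  have h := (Fd_hasDerivAt k (s ^ 2)).comp s (hasDerivAt_pow 2 s)
  simpa [Function.comp_def] using h

lemma Fd_comp_neg (k : ℕ) (c s : ℝ) :
    HasDerivAt (fun s => Fd k (-c * s ^ 2)) (Fd (k + 1) (-c * s ^ 2) * (-c * (2 * s))) s := by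
  have h := (Fd_hasDerivAt k (-c * s ^ 2)).comp s ((hasDerivAt_pow 2 s).const_mul (-c))
  simpa [Function.comp_def] using h

lemma F1_sinh (s : ℝ) : Fd 1 (s ^ 2) * (2 * s) = Real.sinh s := by
  have h := Fd_comp 0 s
  simp only [F0_cosh] at h
  exact h.unique (Real.hasDerivAt_cosh s)

lemma F1_sin (s : ℝ) : Fd 1 (-s ^ 2) * (2 * s) = Real.sin s := by
  have h := Fd_comp_neg 0 1 s
  simp only [neg_one_mul, F0_cos] at h
  have := h.unique (Real.hasDerivAt_cos s)
  linarith

lemma ode_zero (t : ℝ) : 4 * t * Fd 2 t + 2 * Fd 1 t = Fd 0 t := by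
  rcases le_total 0 t with ht | ht
  · obtain ⟨s, rfl⟩ : ∃ s : ℝ, t = s ^ 2 := ⟨√t, (Real.sq_sqrt ht).symm⟩
    have h := (Fd_comp 1 s).mul ((hasDerivAt_id s).const_mul 2)
    have h2 : HasDerivAt Real.sinh _ s :=
      h.congr_of_eventuallyEq (Filter.Eventually.of_forall fun x => (F1_sinh x).symm)
    have := h2.unique (Real.hasDerivAt_sinh s)
    rw [F0_cosh, ← this]; simp; ring
  · obtain ⟨s, rfl⟩ : ∃ s : ℝ, t = -s ^ 2 :=
      ⟨√(-t), by rw [Real.sq_sqrt (by linarith)]; ring⟩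
    have h := (Fd_comp_neg 1 1 s).mul ((hasDerivAt_id s).const_mul 2)
    have h2 : HasDerivAt Real.sin _ s :=
      h.congr_of_eventuallyEq (Filter.Eventually.of_forall fun x => by
        simp only [Pi.mul_apply, neg_one_mul, id]; exact (F1_sin x).symm)
    have := h2.unique (Real.hasDerivAt_sin s)
    rw [F0_cos, ← this]; simp; ring

lemma ode (k : ℕ) : ∀ t : ℝ,
    4 * t * Fd (k + 2) t + (4 * k + 2) * Fd (k + 1) t = Fd k t := by
  induction k with
  | zero => intro t; simpa using ode_zero t
  | succ k ih =>
    intro t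
    have h := ((((hasDerivAt_id t).const_mul 4).mul (Fd_hasDerivAt (k + 2) t)).add
      ((Fd_hasDerivAt (k + 1) t).const_mul (4 * (k : ℝ) + 2)))
    have h2 : HasDerivAt (Fd k) _ t :=
      h.congr_of_eventuallyEq (Filter.Eventually.of_forall fun x => (ih x).symm)
    have := h2.unique (Fd_hasDerivAt k t)
    rw [← this]; simp; ring

lemma F1_pos (t : ℝ) (ht : 0 ≤ t) : 0 < Fd 1 t := by
  rcases ht.eq_or_lt with rfl | ht
  · have h := ode_zero 0
    have h1 := F0_cosh 0
    simp at h h1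
    linarith
  · have h := F1_sinh (√t)
    rw [Real.sq_sqrt ht.le] at h
    have h1 : 0 < √t := Real.sqrt_pos.2 ht
    have h2 : 0 < Real.sinh √t := Real.sinh_pos_iff.2 h1
    by_contra hc
    push Not at hc
    nlinarith

lemma bdd_of_far (k : ℕ) (C : ℝ) (h : ∀ t ≤ -1, |Fd k t| ≤ C) :
    ∃ C, 0 ≤ C ∧ ∀ t ≤ 0, |Fd k t| ≤ C := by
  obtain ⟨M, hM⟩ := (isCompact_Icc (a := (-1 : ℝ)) (b := 0)).exists_bound_of_continuousOn
    (Fd_continuous k).continuousOn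
  refine ⟨max 0 (max C M), le_max_left _ _, fun t ht => ?_⟩
  rcases le_total t (-1) with h1 | h1
  · exact (h t h1).trans ((le_max_left _ _).trans (le_max_right _ _))
  · exact (hM t ⟨h1, ht⟩).trans ((le_max_right _ _).trans (le_max_right _ _))

lemma Fd_bdd (k : ℕ) : (∃ C, 0 ≤ C ∧ ∀ t ≤ 0, |Fd k t| ≤ C) ∧
    (∃ C, 0 ≤ C ∧ ∀ t ≤ 0, |Fd (k + 1) t| ≤ C) := by
  induction k with
  | zero =>
    constructor
    · refine ⟨1, by norm_num, fun t ht => ?_⟩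
      have := F0_cos √(-t)
      rw [Real.sq_sqrt (by linarith), neg_neg] at this
      rw [this]; exact Real.abs_cos_le_one _
    · refine bdd_of_far _ 1 fun t ht => ?_
      have h := F1_sin √(-t)
      rw [Real.sq_sqrt (by linarith), neg_neg] at h
      have h1 : 1 ≤ √(-t) := Real.one_le_sqrt.2 (by linarith)
      have h2 := Real.abs_sin_le_one √(-t)
      rw [← h, abs_mul, abs_of_nonneg (by linarith : 0 ≤ 2 * √(-t))] at h2
      have := abs_nonneg (Fd (0 + 1) t)
      simp only [zero_add] at *
      nlinarith
  | succ k ih =>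
    refine ⟨ih.2, ?_⟩
    obtain ⟨⟨C0, hC0, h0⟩, C1, hC1, h1⟩ := ih
    refine bdd_of_far _ ((4 * k + 2) * C1 + C0) fun t ht => ?_
    have h := ode k t
    have e : Fd (k + 2) t * (4 * t) = Fd k t - (4 * k + 2) * Fd (k + 1) t := by linarith
    have e2 : |Fd (k + 2) t| * (4 * (-t)) ≤ (4 * k + 2) * C1 + C0 := by
      have : |Fd (k + 2) t| * (4 * (-t)) = |Fd (k + 2) t * (4 * t)| := by
        rw [abs_mul, abs_of_nonpos (by linarith : 4 * t ≤ 0)]; ring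
      rw [this, e]
      refine (abs_sub _ _).trans ?_
      rw [abs_mul, abs_of_nonneg (by positivity : (0 : ℝ) ≤ 4 * k + 2)]
      have := h0 t (by linarith)
      have := h1 t (by linarith)
      have : (4 * (k : ℝ) + 2) * |Fd (k + 1) t| ≤ (4 * k + 2) * C1 := by gcongr
      linarith
    have := abs_nonneg (Fd (k + 2) t)
    show |Fd (k + 2) t| ≤ _
    nlinarith

lemma Fd_decay (k : ℕ) : ∃ C, 0 ≤ C ∧ ∀ y, 0 ≤ y → |Fd (k + 2) (-y)| * (1 + y) ≤ C := by
  obtain ⟨⟨C0, hC0, h0⟩, C1, hC1, h1⟩ := Fd_bdd k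
  obtain ⟨C2, hC2, h2⟩ := (Fd_bdd (k + 1)).2
  refine ⟨C2 + ((4 * k + 2) * C1 + C0), by positivity, fun y hy => ?_⟩
  have h := ode k (-y)
  have e : Fd (k + 2) (-y) * (-(4 * y)) = Fd k (-y) - (4 * k + 2) * Fd (k + 1) (-y) := by linarith
  have e2 : |Fd (k + 2) (-y)| * (4 * y) ≤ (4 * k + 2) * C1 + C0 := by
    have : |Fd (k + 2) (-y)| * (4 * y) = |Fd (k + 2) (-y) * (-(4 * y))| := by
      rw [abs_mul, abs_neg, abs_of_nonneg (by linarith : 0 ≤ 4 * y)]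
    rw [this, e]
    refine (abs_sub _ _).trans ?_
    rw [abs_mul, abs_of_nonneg (by positivity : (0 : ℝ) ≤ 4 * k + 2)]
    have := h0 (-y) (by linarith)
    have := h1 (-y) (by linarith)
    have : (4 * (k : ℝ) + 2) * |Fd (k + 1) (-y)| ≤ (4 * k + 2) * C1 := by gcongr
    linarith
  have a := h2 (-y) (by linarith)
  have b : 0 ≤ |Fd (k + 2) (-y)| * y := by positivity
  have a' : |Fd (k + 2) (-y)| ≤ C2 := a
  nlinarith

/-- Families `f λ s` which are finite sums of terms `G(s²) λ^{2k} F^{(k)}(-λ²s²)`, `k ≤ n`. -/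
inductive QF : ℕ → (ℝ → ℝ → ℝ) → Prop
  | base (n k : ℕ) (G : ℝ → ℝ) (f : ℝ → ℝ → ℝ) (hk : k ≤ n)
      (hG : ∀ t, 0 ≤ t → AnalyticAt ℝ G t)
      (h : ∀ l s, 0 < s → f l s = G (s ^ 2) * l ^ (2 * k) * Fd k (-(l ^ 2) * s ^ 2)) : QF n f
  | add (n : ℕ) (f g h : ℝ → ℝ → ℝ) (hf : QF n f) (hg : QF n g)
      (e : ∀ l s, 0 < s → h l s = f l s + g l s) : QF n h

lemma QF_step {n : ℕ} {f : ℝ → ℝ → ℝ} (hf : QF n f) :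
    (∀ l s, 0 < s → DifferentiableAt ℝ (f l) s) ∧
    ∀ A : ℝ → ℝ, (∀ t, 0 ≤ t → AnalyticAt ℝ A t) → ∀ g : ℝ → ℝ → ℝ,
      (∀ l s, 0 < s → g l s = A (s ^ 2) * (deriv (f l) s / (2 * s))) → QF (n + 1) g := by
  induction hf with
  | base k G f hk hG h =>
    have hd : ∀ l s, 0 < s → HasDerivAt (f l)
        (deriv G (s ^ 2) * (2 * s) * l ^ (2 * k) * Fd k (-(l ^ 2) * s ^ 2) +
          G (s ^ 2) * l ^ (2 * k) * (Fd (k + 1) (-(l ^ 2) * s ^ 2) * (-(l ^ 2) * (2 * s)))) s := by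
      intro l s hs
      have h1 : HasDerivAt (fun s => G (s ^ 2)) (deriv G (s ^ 2) * (2 * s)) s := by
        have h := ((hG (s ^ 2) (by positivity)).differentiableAt.hasDerivAt).comp s
          (hasDerivAt_pow 2 s)
        simpa [Function.comp_def] using h
      refine ((h1.mul_const (l ^ (2 * k))).mul (Fd_comp_neg k (l ^ 2) s)).congr_of_eventuallyEq ?_
      filter_upwards [lt_mem_nhds hs] with x hx
      exact h l x hx
    refine ⟨fun l s hs => (hd l s hs).differentiableAt, fun A hA g hg => ?_⟩
    refine QF.add _ (fun l s => (A (s ^ 2) * deriv G (s ^ 2)) * l ^ (2 * k) *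
        Fd k (-(l ^ 2) * s ^ 2))
      (fun l s => (-(A (s ^ 2) * G (s ^ 2))) * l ^ (2 * (k + 1)) *
        Fd (k + 1) (-(l ^ 2) * s ^ 2)) _ ?_ ?_ ?_
    · exact QF.base _ k (fun t => A t * deriv G t) _ (by omega)
        (fun t ht => (hA t ht).mul (hG t ht).deriv) (fun l s hs => rfl)
    · exact QF.base _ (k + 1) (fun t => -(A t * G t)) _ (by omega)
        (fun t ht => ((hA t ht).mul (hG t ht)).neg) (fun l s hs => rfl)
    · intro l s hs
      rw [hg l s hs, (hd l s hs).deriv]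
      field_simp
      ring
  | add f g h hf hg e ihf ihg =>
    have hd : ∀ l s, 0 < s → HasDerivAt (h l) (deriv (f l) s + deriv (g l) s) s := by
      intro l s hs
      refine ((ihf.1 l s hs).hasDerivAt.add (ihg.1 l s hs).hasDerivAt).congr_of_eventuallyEq ?_
      filter_upwards [lt_mem_nhds hs] with x hx
      exact e l x hx
    refine ⟨fun l s hs => (hd l s hs).differentiableAt, fun A hA u hu => ?_⟩
    refine QF.add _ _ _ _ (ihf.2 A hA _ fun l s hs => rfl) (ihg.2 A hA _ fun l s hs => rfl) ?_
    intro l s hs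
    rw [hu l s hs, (hd l s hs).deriv]; ring

lemma QF_bound {n : ℕ} {f : ℝ → ℝ → ℝ} (hf : QF n f) (hn : 2 ≤ n) :
    ∃ C, 0 ≤ C ∧ ∀ l, 1 ≤ l → ∀ s, 0 < s → s ≤ 6 →
      |f l s| * (1 + l * s) ^ 2 ≤ C * l ^ (2 * n) := by
  induction hf with
  | base k G f hk hG h =>
    obtain ⟨M, hM⟩ := (isCompact_Icc (a := (0 : ℝ)) (b := 36)).exists_bound_of_continuousOn
      (f := G) (fun t ht => (hG t ht.1).continuousAt.continuousWithinAt)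
    have hM0 : 0 ≤ M := (norm_nonneg _).trans (hM 0 (by norm_num))
    have hGb : ∀ s : ℝ, 0 < s → s ≤ 6 → |G (s ^ 2)| ≤ M := fun s h1 h2 =>
      hM (s ^ 2) ⟨by positivity, by nlinarith⟩
    have key : ∃ C, 0 ≤ C ∧ ∀ l, 1 ≤ l → ∀ s, 0 < s → s ≤ 6 →
        l ^ (2 * k) * (|Fd k (-(l ^ 2) * s ^ 2)| * (1 + l * s) ^ 2) ≤ C * l ^ (2 * n) := by
      rcases lt_or_ge k 2 with hk2 | hk2
      · obtain ⟨C, hC, hb⟩ := (Fd_bdd k).1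
        refine ⟨C * 49, by positivity, fun l hl s hs hs6 => ?_⟩
        have h1 := hb (-(l ^ 2) * s ^ 2) (by nlinarith [mul_nonneg (sq_nonneg l) (sq_nonneg s)])
        have h2 : (1 + l * s) ^ 2 ≤ 49 * l ^ 2 := by
          have : 1 + l * s ≤ 7 * l := by nlinarith
          calc (1 + l * s) ^ 2 ≤ (7 * l) ^ 2 := by gcongr
            _ = _ := by ring
        calc l ^ (2 * k) * (|Fd k (-(l ^ 2) * s ^ 2)| * (1 + l * s) ^ 2)
            ≤ l ^ (2 * k) * (C * (49 * l ^ 2)) := by gcongr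
          _ = C * 49 * l ^ (2 * k + 2) := by ring
          _ ≤ C * 49 * l ^ (2 * n) := by
            gcongr
            omega
      · obtain ⟨j, rfl⟩ : ∃ j, k = j + 2 := ⟨k - 2, by omega⟩
        obtain ⟨C, hC, hb⟩ := Fd_decay j
        refine ⟨C * 2, by positivity, fun l hl s hs hs6 => ?_⟩
        have h1 := hb (l ^ 2 * s ^ 2) (by positivity)
        rw [← neg_mul] at h1
        have h2 : (1 + l * s) ^ 2 ≤ 2 * (1 + l ^ 2 * s ^ 2) := by nlinarith [sq_nonneg (1 - l * s)]
        calc l ^ (2 * (j + 2)) * (|Fd (j + 2) (-(l ^ 2) * s ^ 2)| * (1 + l * s) ^ 2)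
            ≤ l ^ (2 * (j + 2)) * (|Fd (j + 2) (-(l ^ 2) * s ^ 2)| * (2 * (1 + l ^ 2 * s ^ 2))) := by
              gcongr
          _ = l ^ (2 * (j + 2)) * (2 * (|Fd (j + 2) (-(l ^ 2) * s ^ 2)| * (1 + l ^ 2 * s ^ 2))) := by
              ring
          _ ≤ l ^ (2 * (j + 2)) * (2 * C) := by gcongr
          _ = C * 2 * l ^ (2 * (j + 2)) := by ring
          _ ≤ C * 2 * l ^ (2 * n) := by
            gcongr
    obtain ⟨C, hC, hb⟩ := key
    refine ⟨M * C, by positivity, fun l hl s hs hs6 => ?_⟩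
    rw [h l s hs, abs_mul, abs_mul, abs_of_nonneg (by positivity : 0 ≤ l ^ (2 * k))]
    calc _ = |G (s ^ 2)| * (l ^ (2 * k) * (|Fd k (-(l ^ 2) * s ^ 2)| * (1 + l * s) ^ 2)) := by ring
      _ ≤ M * (C * l ^ (2 * n)) := by
        exact mul_le_mul (hGb s hs hs6) (hb l hl s hs hs6) (by positivity) hM0
      _ = _ := by ring
  | add f g h hf hg e ihf ihg =>
    obtain ⟨C1, hC1, h1⟩ := ihf
    obtain ⟨C2, hC2, h2⟩ := ihg
    refine ⟨C1 + C2, by positivity, fun l hl s hs hs6 => ?_⟩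
    rw [e l s hs]
    have := abs_add_le (f l s) (g l s)
    calc _ ≤ (|f l s| + |g l s|) * (1 + l * s) ^ 2 := by gcongr
      _ ≤ _ := by linarith [h1 l hl s hs hs6, h2 l hl s hs hs6]

lemma QF_D1 {n : ℕ} {f : ℝ → ℝ → ℝ} (hf : QF n f) : QF (n + 1) (fun l => D1 (f l)) := by
  refine (QF_step hf).2 (fun t => -(Fd 1 t)⁻¹)
    (fun t ht => ((Fd_analytic 1 t).inv (F1_pos t ht).ne').neg) _ fun l s hs => ?_
  have h := F1_pos (s ^ 2) (by positivity)
  simp only [D1]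
  rw [← F1_sinh s]
  field_simp

lemma QF_D2 {n : ℕ} {f : ℝ → ℝ → ℝ} (hf : QF n f) : QF (n + 1) (fun l => D2 (f l)) := by
  refine (QF_step hf).2 (fun t => -(2 * (Fd 1 (t / 4))⁻¹))
    (fun t ht => ?_) _ fun l s hs => ?_
  · have h0 : AnalyticAt ℝ (fun t : ℝ => t / 4) t := analyticAt_id.div_const
    have h1 : AnalyticAt ℝ (fun t : ℝ => Fd 1 (t / 4)) t :=
      AnalyticAt.fun_comp (Fd_analytic 1 (t / 4)) h0
    have h2 := h1.inv (F1_pos (t / 4) (by positivity)).ne'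
    exact (analyticAt_const.mul h2).neg
  have h := F1_pos (s ^ 2 / 4) (by positivity)
  simp only [D2]
  rw [← F1_sinh (s / 2), show (s / 2) ^ 2 = s ^ 2 / 4 by ring]
  field_simp

lemma QF_iter1 {n : ℕ} {f : ℝ → ℝ → ℝ} (hf : QF n f) (p : ℕ) :
    QF (n + p) (fun l => D1^[p] (f l)) := by
  induction p with
  | zero => exact hf
  | succ p ih =>
    simp only [Function.iterate_succ_apply']
    exact QF_D1 ih

lemma QF_iter2 {n : ℕ} {f : ℝ → ℝ → ℝ} (hf : QF n f) (p : ℕ) :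
    QF (n + p) (fun l => D2^[p] (f l)) := by
  induction p with
  | zero => exact hf
  | succ p ih =>
    simp only [Function.iterate_succ_apply']
    exact QF_D2 ih

lemma QF_main (p q : ℕ) :
    QF (0 + q + p) (fun l => D1^[p] (D2^[q] fun u : ℝ => Real.cos (l * u))) := by
  refine QF_iter1 (QF_iter2 ?_ q) p
  refine QF.base 0 0 (fun _ => 1) _ le_rfl (fun t _ => analyticAt_const) fun l s _ => ?_
  rw [← F0_cos]
  simp [mul_pow]

lemma kernel_bound : ∃ K, 0 ≤ K ∧ ∀ r s : ℝ, 0 < r → r < s → s ≤ 6 →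
    Real.sinh s / √(Real.cosh s - Real.cosh r) ≤ K * (1 + √r / √(s - r)) := by
  obtain ⟨M, hM⟩ := (isCompact_Icc (a := (0 : ℝ)) (b := 36)).exists_bound_of_continuousOn
      (Fd_continuous 1).continuousOn
  have hM0 : 0 ≤ M := (norm_nonneg _).trans (hM 0 (by norm_num))
  refine ⟨4 * M, by positivity, fun r s hr hrs hs => ?_⟩
  have hs0 : 0 < s := hr.trans hrs
  have hu : 0 < s - r := by linarith
  have h1 : Real.sinh s ≤ M * (2 * s) := by
    rw [← F1_sinh s]
    gcongr
    exact (le_abs_self _).trans (hM (s ^ 2) ⟨by positivity, by nlinarith⟩)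
  have h2 : (s - r) * s / 4 ≤ Real.cosh s - Real.cosh r := by
    have e : Real.cosh s - Real.cosh r = 2 * Real.sinh ((s + r) / 2) * Real.sinh ((s - r) / 2) := by
      have e1 := Real.cosh_add ((s + r) / 2) ((s - r) / 2)
      have e2 := Real.cosh_sub ((s + r) / 2) ((s - r) / 2)
      rw [show (s + r) / 2 + (s - r) / 2 = s by ring] at e1
      rw [show (s + r) / 2 - (s - r) / 2 = r by ring] at e2
      rw [e1, e2]; ring
    have a : (s + r) / 2 ≤ Real.sinh ((s + r) / 2) := Real.self_le_sinh_iff.2 (by linarith)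
    have b : (s - r) / 2 ≤ Real.sinh ((s - r) / 2) := Real.self_le_sinh_iff.2 (by linarith)
    rw [e]
    calc (s - r) * s / 4 ≤ 2 * ((s + r) / 2) * ((s - r) / 2) := by nlinarith
      _ ≤ _ := by gcongr
  have h3 : √(s - r) * √s / 2 ≤ √(Real.cosh s - Real.cosh r) := by
    apply Real.le_sqrt_of_sq_le
    calc (√(s - r) * √s / 2) ^ 2 = √(s - r) ^ 2 * √s ^ 2 / 4 := by ring
      _ = (s - r) * s / 4 := by rw [Real.sq_sqrt hu.le, Real.sq_sqrt hs0.le]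
      _ ≤ _ := h2
  have p1 : 0 < √(s - r) := Real.sqrt_pos.2 hu
  have p2 : 0 < √s := Real.sqrt_pos.2 hs0
  have h4 : √s ≤ √(s - r) + √r := by
    apply Real.sqrt_le_iff.2
    have q1 := Real.sq_sqrt hu.le
    have q2 := Real.sq_sqrt hr.le
    constructor
    · positivity
    · nlinarith [mul_nonneg (Real.sqrt_nonneg (s - r)) (Real.sqrt_nonneg r)]
  calc Real.sinh s / √(Real.cosh s - Real.cosh r) ≤ M * (2 * s) / (√(s - r) * √s / 2) := by
        gcongr
    _ = 4 * M * (√s / √(s - r)) := by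
        field_simp
        rw [Real.sq_sqrt hs0.le]; ring
    _ ≤ 4 * M * ((√(s - r) + √r) / √(s - r)) := by gcongr
    _ = _ := by field_simp

/-- antiderivative of the dominating function -/
noncomputable def anti (l r s : ℝ) : ℝ :=
  -(1 / (l * (1 + l * (s - r)))) + 6 / √l * (√(s - r) / √(1 + l * (s - r)))

/-- the dominating function -/
noncomputable def dom (l r s : ℝ) : ℝ :=
  1 / (1 + l * (s - r)) ^ 2 +
    3 / √l * (1 / (√(s - r) * (√(1 + l * (s - r)) * (1 + l * (s - r)))))

lemma anti_deriv (l r s : ℝ) (hl : 1 ≤ l) (hs : r < s) :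
    HasDerivAt (anti l r) (dom l r s) s := by
  have hu : 0 < s - r := by linarith
  have hv : 0 < 1 + l * (s - r) := by positivity
  have d0 : HasDerivAt (fun s => s - r) 1 s := (hasDerivAt_id s).sub_const r
  have d1 : HasDerivAt (fun s => 1 + l * (s - r)) l s := by
    simpa using (d0.const_mul l).const_add 1
  have d2 := d0.sqrt hu.ne'
  have d3 := d1.sqrt hv.ne'
  have d4 := ((d1.const_mul l).fun_inv (by positivity)).neg
  have d5 := (d2.div d3 (by positivity)).const_mul (6 / √l)
  have d := d4.add d5
  have p1 : 0 < √(s - r) := Real.sqrt_pos.2 hu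
  have p2 : 0 < √(1 + l * (s - r)) := Real.sqrt_pos.2 hv
  have p3 : 0 < √l := by positivity
  have hfun : anti l r = (-fun i => (l * (1 + l * (i - r)))⁻¹) +
      fun y => 6 / √l * ((fun y => √(y - r)) / fun y => √(1 + l * (y - r))) y := by
    ext x; simp only [anti, Pi.add_apply, Pi.neg_apply, Pi.div_apply, one_div]
  rw [hfun]
  refine d.congr_deriv (Eq.symm ?_)
  · have e1 : √(s - r) ^ 2 = s - r := Real.sq_sqrt hu.le
    have e2 : √(1 + l * (s - r)) ^ 2 = 1 + l * (s - r) := Real.sq_sqrt hv.le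
    unfold dom
    have k1 : 1 / (1 + l * (s - r)) ^ 2 = -(-(l * l) / (l * (1 + l * (s - r))) ^ 2) := by
      field_simp
    have k2 : 3 / √l * (1 / (√(s - r) * (√(1 + l * (s - r)) * (1 + l * (s - r))))) =
        6 / √l * ((1 / (2 * √(s - r)) * √(1 + l * (s - r)) -
          √(s - r) * (l / (2 * √(1 + l * (s - r))))) / √(1 + l * (s - r)) ^ 2) := by
      rw [e2]
      have : 1 / (2 * √(s - r)) * √(1 + l * (s - r)) -
          √(s - r) * (l / (2 * √(1 + l * (s - r)))) =
          1 / (2 * √(s - r) * √(1 + l * (s - r))) := by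
        field_simp
        rw [e1, mul_comm (s - r) l, e2]; ring
      rw [this]
      field_simp
      ring
    rw [k1, k2]

lemma anti_cont (l r : ℝ) (hl : 1 ≤ l) : ContinuousOn (anti l r) (Set.Icc r 6) := by
  have h : ∀ s ∈ Set.Icc r 6, 0 < 1 + l * (s - r) := fun s hs => by
    have : 0 ≤ s - r := by linarith [hs.1]
    positivity
  unfold anti
  refine ContinuousOn.add (ContinuousOn.neg (ContinuousOn.div (by fun_prop) (by fun_prop) ?_))
    (ContinuousOn.mul (by fun_prop) (ContinuousOn.div (by fun_prop) (by fun_prop) ?_))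
  · intro s hs; have := h s hs; positivity
  · intro s hs; have := h s hs; positivity

lemma dom_nonneg (l r s : ℝ) (hl : 1 ≤ l) (hs : r < s) : 0 ≤ dom l r s := by
  have hu : 0 < s - r := by linarith
  unfold dom; positivity

lemma dom_int (l r : ℝ) (hl : 1 ≤ l) (hr : r ≤ 6) :
    IntervalIntegrable (dom l r) MeasureTheory.volume r 6 ∧
      ∫ s in r..6, dom l r s ≤ 7 / l := by
  have hi : IntervalIntegrable (dom l r) MeasureTheory.volume r 6 := by
    rw [intervalIntegrable_iff_integrableOn_Ioc_of_le hr]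
    exact intervalIntegral.integrableOn_deriv_of_nonneg (anti_cont l r hl)
      (fun x hx => anti_deriv l r x hl hx.1) (fun x hx => dom_nonneg l r x hl hx.1)
  refine ⟨hi, ?_⟩
  rw [intervalIntegral.integral_eq_sub_of_hasDerivAt_of_le hr (anti_cont l r hl)
    (fun x hx => anti_deriv l r x hl hx.1) hi]
  have h1 : anti l r r = -(1 / l) := by simp [anti]
  have hu : 0 ≤ 6 - r := by linarith
  have hl0 : 0 < l := by linarith
  have p3 : 0 < √l := by positivity
  have p4 : 0 < √(1 + l * (6 - r)) := by positivity
  have h2 : anti l r 6 ≤ 6 / l := by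
    have a : 0 ≤ 1 / (l * (1 + l * (6 - r))) := by positivity
    have b : √(6 - r) / √(1 + l * (6 - r)) ≤ 1 / √l := by
      rw [div_le_div_iff₀ p4 p3, ← Real.sqrt_mul hu, one_mul]
      apply Real.sqrt_le_sqrt
      linarith
    have c : 6 / √l * (√(6 - r) / √(1 + l * (6 - r))) ≤ 6 / √l * (1 / √l) := by gcongr
    have d : 6 / √l * (1 / √l) = 6 / l := by
      rw [div_mul_div_comm, Real.mul_self_sqrt hl0.le, mul_one]
    unfold anti
    linarith
  rw [h1]
  have : 7 / l = 6 / l + 1 / l := by ring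
  linarith

lemma dom_le (l r s : ℝ) (hl : 1 ≤ l) (hr : 0 < r) (hs : r < s) (hlr : l * r ≤ 6) :
    (1 + √r / √(s - r)) * (1 / (1 + l * s) ^ 2) ≤ dom l r s := by
  have hu : 0 < s - r := by linarith
  have hl0 : 0 < l := by linarith
  have hv : 1 ≤ 1 + l * (s - r) := by nlinarith
  have hw : 1 / (1 + l * s) ^ 2 ≤ 1 / (1 + l * (s - r)) ^ 2 := by
    gcongr; linarith
  have p1 : 0 < √(s - r) := Real.sqrt_pos.2 hu
  have p3 : 0 < √l := by positivity
  have hr3 : √r ≤ 3 / √l := by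
    rw [le_div_iff₀ p3, ← Real.sqrt_mul hr.le]
    apply Real.sqrt_le_iff.2
    constructor <;> linarith
  have hq : √(1 + l * (s - r)) * (1 + l * (s - r)) ≤ (1 + l * (s - r)) ^ 2 := by
    have : √(1 + l * (s - r)) ≤ 1 + l * (s - r) := by
      apply Real.sqrt_le_iff.2
      constructor <;> nlinarith
    nlinarith
  have hpos : 0 < √(1 + l * (s - r)) * (1 + l * (s - r)) := by positivity
  calc (1 + √r / √(s - r)) * (1 / (1 + l * s) ^ 2)
      ≤ (1 + √r / √(s - r)) * (1 / (1 + l * (s - r)) ^ 2) := by gcongr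
    _ = 1 / (1 + l * (s - r)) ^ 2 + √r * (1 / (√(s - r) * (1 + l * (s - r)) ^ 2)) := by
      field_simp
    _ ≤ dom l r s := by
      unfold dom
      gcongr

theorem stmt12 (p q : ℕ) (hp : 1 ≤ p) (hq : 1 ≤ q) (ε : ℝ) (hε : 0 < ε) :
    ∃ C : ℝ, 0 ≤ C ∧ ∀ lam : ℝ, 1 ≤ lam → ∀ r : ℝ, 0 < r → r ≤ 3 → lam * r ≤ 6 →
      |∫ s in r..6, Real.sinh s / Real.sqrt (Real.cosh s - Real.cosh r) *
          D1^[p] (D2^[q] fun u : ℝ => Real.cos (lam * u)) s| ≤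
        C * lam ^ (2 * (p : ℝ) + 2 * q - 1 - ε) * r ^ (-ε) := by
  obtain ⟨K, hK, hk⟩ := kernel_bound
  obtain ⟨C, hC, hb⟩ := QF_bound (QF_main p q) (by omega)
  refine ⟨K * C * 7 * 6 ^ ε, by positivity, fun l hl r hr hr3 hlr => ?_⟩
  have hl0 : 0 < l := by linarith
  obtain ⟨hi, hint⟩ := dom_int l r hl (by linarith)
  have main : ‖∫ s in r..6, Real.sinh s / Real.sqrt (Real.cosh s - Real.cosh r) *
      D1^[p] (D2^[q] fun u : ℝ => Real.cos (l * u)) s‖ ≤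
      ∫ s in r..6, (K * C * l ^ (2 * (0 + q + p))) * dom l r s := by
    refine intervalIntegral.norm_integral_le_of_norm_le (by linarith)
      (Filter.Eventually.of_forall fun s hs => ?_) (hi.const_mul _)
    have hs0 : 0 < s := hr.trans hs.1
    have h1 := hk r s hr hs.1 hs.2
    have h2 := hb l hl s hs0 hs.2
    have h3 := dom_le l r s hl hr hs.1 hlr
    rw [Real.norm_eq_abs, abs_mul]
    have h4 : 0 ≤ Real.sinh s / √(Real.cosh s - Real.cosh r) :=
      div_nonneg (Real.sinh_nonneg_iff.2 hs0.le) (Real.sqrt_nonneg _)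
    rw [abs_of_nonneg h4]
    have h5 : |D1^[p] (D2^[q] fun u : ℝ => Real.cos (l * u)) s| ≤
        C * l ^ (2 * (0 + q + p)) * (1 / (1 + l * s) ^ 2) := by
      rw [mul_one_div, le_div_iff₀ (by positivity)]
      exact h2
    calc _ ≤ (K * (1 + √r / √(s - r))) * (C * l ^ (2 * (0 + q + p)) * (1 / (1 + l * s) ^ 2)) := by
          gcongr
      _ = (K * C * l ^ (2 * (0 + q + p))) * ((1 + √r / √(s - r)) * (1 / (1 + l * s) ^ 2)) := by ring
      _ ≤ _ := by gcongr
  rw [Real.norm_eq_abs, intervalIntegral.integral_const_mul] at main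
  refine main.trans ?_
  have e1 : l ^ (2 * (p : ℝ) + 2 * q - 1 - ε) = l ^ (2 * (0 + q + p)) / l * l ^ (-ε) := by
    rw [show 2 * (p : ℝ) + 2 * q - 1 - ε = ((2 * (0 + q + p) : ℕ) : ℝ) - 1 + (-ε) by
      push_cast; ring, Real.rpow_add hl0, Real.rpow_sub_one hl0.ne', Real.rpow_natCast]
  have e2 : 1 ≤ 6 ^ ε * (l ^ (-ε) * r ^ (-ε)) := by
    rw [← Real.mul_rpow hl0.le hr.le, Real.rpow_neg (by positivity), ← div_eq_mul_inv,
      one_le_div (by positivity)]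
    exact Real.rpow_le_rpow (by positivity) hlr hε.le
  rw [e1]
  calc K * C * l ^ (2 * (0 + q + p)) * ∫ s in r..6, dom l r s
      ≤ K * C * l ^ (2 * (0 + q + p)) * (7 / l) := by gcongr
    _ = (K * C * 7 * (l ^ (2 * (0 + q + p)) / l)) * 1 := by ring
    _ ≤ (K * C * 7 * (l ^ (2 * (0 + q + p)) / l)) * (6 ^ ε * (l ^ (-ε) * r ^ (-ε))) := by gcongr
    _ = _ := by ring
end

section
/- Let p, q ≥ 1 be integers. Then there exist smooth functions γ_1, …, γ_{p+q} : (0,∞) → ℝ and a constant C ≥ 0 with |γ_j(r)| ≤ C · e^{−(p + q/2)·r} for all r ≥ 1 and all 1 ≤ j ≤ p+q, such that for every smooth function f : (0,∞) → ℂ and every r > 0, (D₁^p D₂^q f)(r) = Σ_{j=1}^{p+q} γ_j(r) · f^{(j)}(r). -/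
/-- The operator `D₁ f(r) = -f'(r) / sinh r` on complex-valued functions. -/
noncomputable def D1c (f : ℝ → ℂ) : ℝ → ℂ := fun r => -deriv f r / (Real.sinh r : ℂ)

/-- The operator `D₂ f(r) = -f'(r) / sinh(r/2)` on complex-valued functions. -/
noncomputable def D2c (f : ℝ → ℂ) : ℝ → ℂ := fun r => -deriv f r / (Real.sinh (r / 2) : ℂ)

namespace Aux16

/-- The algebra of functions generated by constants and `coth (k r)`, `k ≥ 1/2`. -/
inductive Alg : (ℝ → ℝ) → Prop
  | const (c : ℝ) : Alg (fun _ => c)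
  | coth (k : ℝ) (hk : 1 / 2 ≤ k) : Alg (fun r => Real.cosh (k * r) / Real.sinh (k * r))
  | add (f g : ℝ → ℝ) : Alg f → Alg g → Alg (fun r => f r + g r)
  | mul (f g : ℝ → ℝ) : Alg f → Alg g → Alg (fun r => f r * g r)

lemma sinh_lower {x : ℝ} (hx : 1 / 2 ≤ x) : Real.exp x / 4 ≤ Real.sinh x := by
  rw [Real.sinh_eq]
  have h1 : Real.exp (-x) * Real.exp x = 1 := by rw [← Real.exp_add]; simp
  have h2 : 2 ≤ Real.exp x * Real.exp x := by
    rw [← Real.exp_add]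
    have := Real.add_one_le_exp (x + x)
    linarith
  have h3 := Real.exp_pos (-x)
  have h4 := Real.exp_pos x
  have : Real.exp (-x) * 2 ≤ Real.exp x := by
    nlinarith [mul_le_mul_of_nonneg_left h2 h3.le]
  linarith

lemma half_le {k r : ℝ} (hk : 1 / 2 ≤ k) (hr : 1 ≤ r) : 1 / 2 ≤ k * r := by nlinarith

lemma sinh_pos' {k r : ℝ} (hk : 1 / 2 ≤ k) (hr : 0 < r) : 0 < Real.sinh (k * r) :=
  Real.sinh_pos_iff.2 (mul_pos (by linarith) hr)

lemma inv_sinh_le {k r : ℝ} (hk : 1 / 2 ≤ k) (hr : 1 ≤ r) :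
    |(Real.sinh (k * r))⁻¹| ≤ 4 * Real.exp (-(k * r)) := by
  have h := sinh_lower (half_le hk hr)
  have hp := sinh_pos' hk (by linarith : 0 < r)
  rw [abs_of_pos (inv_pos.2 hp), Real.exp_neg, inv_le_comm₀ hp (by positivity)]
  rw [mul_inv, inv_inv]
  linarith

lemma Alg.contDiffOn {g : ℝ → ℝ} (h : Alg g) :
    ContDiffOn ℝ (⊤ : ℕ∞) g (Set.Ioi 0) := by
  induction h with
  | const c => exact contDiffOn_const
  | coth k hk =>
    apply ContDiffOn.div
    · exact (Real.contDiff_cosh.comp (contDiff_const.mul contDiff_id)).contDiffOn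
    · exact (Real.contDiff_sinh.comp (contDiff_const.mul contDiff_id)).contDiffOn
    · intro x hx
      exact (sinh_pos' hk hx).ne'
  | add f g _ _ h1 h2 => exact h1.add h2
  | mul f g _ _ h1 h2 => exact h1.mul h2

lemma Alg.bdd {g : ℝ → ℝ} (h : Alg g) :
    ∃ C : ℝ, 0 ≤ C ∧ ∀ r : ℝ, 1 ≤ r → |g r| ≤ C := by
  induction h with
  | const c => exact ⟨|c|, abs_nonneg _, fun _ _ => le_rfl⟩
  | coth k hk =>
    refine ⟨4, by norm_num, fun r hr => ?_⟩
    have h := sinh_lower (half_le hk hr)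
    have hp := sinh_pos' hk (by linarith : 0 < r)
    rw [abs_of_pos (div_pos (Real.cosh_pos _) hp), div_le_iff₀ hp]
    have : Real.cosh (k * r) ≤ Real.exp (k * r) := by
      rw [← Real.cosh_add_sinh]; linarith
    linarith
  | add f g _ _ h1 h2 =>
    obtain ⟨C, hC, h1⟩ := h1
    obtain ⟨D, hD, h2⟩ := h2
    exact ⟨C + D, by positivity, fun r hr =>
      (abs_add_le _ _).trans (add_le_add (h1 r hr) (h2 r hr))⟩
  | mul f g _ _ h1 h2 =>
    obtain ⟨C, hC, h1⟩ := h1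
    obtain ⟨D, hD, h2⟩ := h2
    refine ⟨C * D, by positivity, fun r hr => ?_⟩
    rw [abs_mul]
    exact mul_le_mul (h1 r hr) (h2 r hr) (abs_nonneg _) hC

lemma Alg.der {g : ℝ → ℝ} (h : Alg g) :
    ∃ g' : ℝ → ℝ, Alg g' ∧ ∀ r : ℝ, 0 < r → HasDerivAt g (g' r) r := by
  induction h with
  | const c => exact ⟨_, Alg.const 0, fun r _ => hasDerivAt_const _ _⟩
  | coth k hk =>
    refine ⟨_, Alg.add _ _ (Alg.const k) (Alg.mul _ _ (Alg.const (-k))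
      (Alg.mul _ _ (Alg.coth k hk) (Alg.coth k hk))), fun r hr => ?_⟩
    have hp := (sinh_pos' hk hr).ne'
    have h0 : HasDerivAt (fun r : ℝ => k * r) k r := by
      simpa using (hasDerivAt_id r).const_mul k
    refine (h0.cosh.div h0.sinh hp).congr_deriv ?_
    field_simp
    ring
  | add f g _ _ h1 h2 =>
    obtain ⟨f', hf, h1⟩ := h1
    obtain ⟨g', hg, h2⟩ := h2
    exact ⟨_, Alg.add _ _ hf hg, fun r hr => (h1 r hr).add (h2 r hr)⟩
  | mul f g af ag h1 h2 =>
    obtain ⟨f', hf, h1⟩ := h1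
    obtain ⟨g', hg, h2⟩ := h2
    exact ⟨_, Alg.add _ _ (Alg.mul _ _ hf ag) (Alg.mul _ _ af hg),
      fun r hr => (h1 r hr).mul (h2 r hr)⟩

/-- Logarithmic derivative in the algebra. -/
def LogD (w : ℝ → ℝ) : Prop :=
  ∃ u : ℝ → ℝ, Alg u ∧ ∀ r : ℝ, 0 < r → HasDerivAt w (w r * u r) r

lemma LogD.mul {w v : ℝ → ℝ} (hw : LogD w) (hv : LogD v) : LogD (fun r => w r * v r) := by
  obtain ⟨a, ha, h1⟩ := hw
  obtain ⟨b, hb, h2⟩ := hv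
  refine ⟨_, Alg.add _ _ ha hb, fun r hr => ?_⟩
  refine ((h1 r hr).mul (h2 r hr)).congr_deriv ?_
  ring

lemma logD_inv (k : ℝ) (hk : 1 / 2 ≤ k) : LogD (fun r => (Real.sinh (k * r))⁻¹) := by
  refine ⟨_, Alg.mul _ _ (Alg.const (-k)) (Alg.coth k hk), fun r hr => ?_⟩
  have hp := (sinh_pos' hk hr).ne'
  have h0 : HasDerivAt (fun r : ℝ => k * r) k r := by
    simpa using (hasDerivAt_id r).const_mul k
  refine (h0.sinh.inv hp).congr_deriv ?_
  field_simp

/-- `T` is a differential operator with coefficients `w * (element of the algebra)`. -/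
def Rep (w : ℝ → ℝ) (n : ℕ) (T : (ℝ → ℂ) → ℝ → ℂ) : Prop :=
  ∃ β : ℕ → ℝ → ℝ, (∀ j, Alg (β j)) ∧
    ∀ f : ℝ → ℂ, ContDiffOn ℝ (⊤ : ℕ∞) f (Set.Ioi 0) → ∀ r : ℝ, 0 < r →
      T f r = ∑ j ∈ Finset.range n, ((w r * β j r : ℝ) : ℂ) * iteratedDeriv (j + 1) f r

lemma hasDerivAt_iter {f : ℝ → ℂ} (hf : ContDiffOn ℝ (⊤ : ℕ∞) f (Set.Ioi 0)) {r : ℝ}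
    (hr : 0 < r) (n : ℕ) : HasDerivAt (iteratedDeriv n f) (iteratedDeriv (n + 1) f r) r := by
  have h : ContDiffAt ℝ (⊤ : ℕ∞) f r := hf.contDiffAt (Ioi_mem_nhds hr)
  rw [iteratedDeriv_succ]
  apply DifferentiableAt.hasDerivAt
  have h2 := ContDiffWithinAt.differentiableWithinAt_iteratedDerivWithin (m := n)
    (s := Set.univ) h.contDiffWithinAt (by exact_mod_cast WithTop.coe_lt_top _)
    (by simpa using uniqueDiffOn_univ)
  rwa [iteratedDerivWithin_univ, differentiableWithinAt_univ] at h2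

lemma Rep.step {w : ℝ → ℝ} {n : ℕ} {T : (ℝ → ℂ) → ℝ → ℂ} (h : Rep w n T) (hw : LogD w)
    (k : ℝ) :
    Rep (fun r => (Real.sinh (k * r))⁻¹ * w r) (n + 1)
      (fun f r => -deriv (T f) r / (Real.sinh (k * r) : ℂ)) := by
  obtain ⟨β, hβ, hT⟩ := h
  obtain ⟨u, hu, hw⟩ := hw
  choose β' hβ' hd using fun j => (hβ j).der
  refine ⟨fun j r => (if j < n then (-1) * (u r * β j r + β' j r) else 0)
    + (if j = 0 then 0 else (-1) * β (j - 1) r), fun j => ?_, fun f hf r hr => ?_⟩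
  · apply Alg.add
    · split_ifs
      · exact Alg.mul _ _ (Alg.const _) (Alg.add _ _ (Alg.mul _ _ hu (hβ j)) (hβ' j))
      · exact Alg.const 0
    · split_ifs
      · exact Alg.const 0
      · exact Alg.mul _ _ (Alg.const _) (hβ _)
  · have hder : HasDerivAt (T f) (∑ j ∈ Finset.range n,
        (((w r * u r * β j r + w r * β' j r : ℝ) : ℂ) * iteratedDeriv (j + 1) f r
          + ((w r * β j r : ℝ) : ℂ) * iteratedDeriv (j + 1 + 1) f r)) r := by
      have h1 : HasDerivAt (fun r => ∑ j ∈ Finset.range n,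
          ((w r * β j r : ℝ) : ℂ) * iteratedDeriv (j + 1) f r) (∑ j ∈ Finset.range n,
        (((w r * u r * β j r + w r * β' j r : ℝ) : ℂ) * iteratedDeriv (j + 1) f r
          + ((w r * β j r : ℝ) : ℂ) * iteratedDeriv (j + 1 + 1) f r)) r := by
        apply HasDerivAt.fun_sum
        intro j _
        exact (((hw r hr).mul (hd j r hr)).ofReal_comp).mul (hasDerivAt_iter hf hr (j + 1))
      apply h1.congr_of_eventuallyEq
      filter_upwards [Ioi_mem_nhds hr] with x hx
      exact hT f hf x hx
    have e1 : ∀ A B : ℕ → ℂ, ∑ j ∈ Finset.range (n + 1), ((if j < n then A j else 0) + 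
        (if j = 0 then 0 else B (j - 1))) = ∑ j ∈ Finset.range n, (A j + B j) := by
      intro A B
      rw [Finset.sum_add_distrib, Finset.sum_range_succ, Finset.sum_range_succ',
        Finset.sum_add_distrib]
      simp only [lt_irrefl, if_false, add_zero, if_true, Nat.add_sub_cancel,
        Nat.succ_ne_zero]
      congr 1
      exact Finset.sum_congr rfl fun j hj => by simp [Finset.mem_range.1 hj]
    show -deriv (T f) r / _ = _
    rw [hder.deriv]
    have := e1 (fun j => -(Real.sinh (k * r) : ℂ)⁻¹ *
        (((w r * u r * β j r + w r * β' j r : ℝ) : ℂ) * iteratedDeriv (j + 1) f r))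
      (fun j => -(Real.sinh (k * r) : ℂ)⁻¹ *
        (((w r * β j r : ℝ) : ℂ) * iteratedDeriv (j + 1 + 1) f r))
    simp only [← mul_add] at this
    rw [← Finset.mul_sum] at this
    rw [neg_div, div_eq_inv_mul, ← neg_mul, ← this]
    refine Finset.sum_congr rfl fun j _ => ?_
    rcases j with _ | j
    · simp only [if_true, add_zero]
      split_ifs <;> push_cast <;> ring
    · simp only [Nat.succ_ne_zero, if_false, Nat.add_sub_cancel]
      split_ifs <;> push_cast <;> ring

/-- Weight. -/
noncomputable def W (p q : ℕ) : ℝ → ℝ := fun r =>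
  (Real.sinh (1 * r))⁻¹ ^ p * (Real.sinh (1 / 2 * r))⁻¹ ^ q

lemma logD_pow {w : ℝ → ℝ} (h : LogD w) (n : ℕ) : LogD (fun r => w r ^ n) := by
  induction n with
  | zero =>
    refine ⟨_, Alg.const 0, fun r _ => ?_⟩
    simpa using hasDerivAt_const r (1 : ℝ)
  | succ n ih => simpa only [pow_succ] using ih.mul h

lemma logD_W (p q : ℕ) : LogD (W p q) :=
  (logD_pow (logD_inv 1 (by norm_num)) p).mul (logD_pow (logD_inv (1 / 2) le_rfl) q)

lemma rep2 (q : ℕ) : Rep (W 0 (q + 1)) (q + 1) (fun f => D2c^[q + 1] f) := by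
  induction q with
  | zero =>
    refine ⟨fun _ _ => -1, fun _ => Alg.const _, fun f hf r hr => ?_⟩
    have : r / 2 = 1 / 2 * r := by ring
    simp only [zero_add, Function.iterate_one, D2c, W, this, Finset.sum_range_one,
      iteratedDeriv_one]
    push_cast
    ring
  | succ q ih =>
    have h := ih.step (logD_W _ _) (1 / 2)
    have e1 : W 0 (q + 1 + 1) = fun r => (Real.sinh (1 / 2 * r))⁻¹ * W 0 (q + 1) r := by
      funext r; simp only [W]; ring
    have e2 : (fun f : ℝ → ℂ => D2c^[q + 1 + 1] f) =
        (fun f r => -deriv (D2c^[q + 1] f) r / (Real.sinh (1 / 2 * r) : ℂ)) := by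
      funext f r
      rw [Function.iterate_succ_apply', D2c, show r / 2 = 1 / 2 * r by ring]
    rw [e1, e2]
    exact h

lemma rep1 (q p : ℕ) :
    Rep (W p (q + 1)) (p + (q + 1)) (fun f => D1c^[p] (D2c^[q + 1] f)) := by
  induction p with
  | zero => simpa only [zero_add, Function.iterate_zero, id] using rep2 q
  | succ p ih =>
    have h := ih.step (logD_W _ _) 1
    have e1 : W (p + 1) (q + 1) = fun r => (Real.sinh (1 * r))⁻¹ * W p (q + 1) r := by
      funext r; simp only [W]; ring
    have e2 : (fun f : ℝ → ℂ => D1c^[p + 1] (D2c^[q + 1] f)) =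
        (fun f r => -deriv (D1c^[p] (D2c^[q + 1] f)) r / (Real.sinh (1 * r) : ℂ)) := by
      funext f r
      rw [Function.iterate_succ_apply', D1c, one_mul]
    rw [e1, e2, show p + 1 + (q + 1) = p + (q + 1) + 1 by ring]
    exact h

lemma W_bound (p q : ℕ) (r : ℝ) (hr : 1 ≤ r) :
    |W p q r| ≤ 4 ^ p * 4 ^ q * Real.exp (-((p : ℝ) + (q : ℝ) / 2) * r) := by
  have h1 := inv_sinh_le (k := 1) (by norm_num) hr
  have h2 := inv_sinh_le (k := 1 / 2) le_rfl hr
  have e : 4 ^ p * 4 ^ q * Real.exp (-((p : ℝ) + (q : ℝ) / 2) * r) =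
      (4 * Real.exp (-(1 * r))) ^ p * (4 * Real.exp (-(1 / 2 * r))) ^ q := by
    have : -((p : ℝ) + (q : ℝ) / 2) * r = p * (-(1 * r)) + q * (-(1 / 2 * r)) := by ring
    rw [this, Real.exp_add, Real.exp_nat_mul, Real.exp_nat_mul]
    ring
  rw [e, W, abs_mul, abs_pow, abs_pow]
  gcongr

lemma W_smooth (p q : ℕ) : ContDiffOn ℝ (⊤ : ℕ∞) (W p q) (Set.Ioi 0) := by
  have key : ∀ k : ℝ, 1 / 2 ≤ k →
      ContDiffOn ℝ (⊤ : ℕ∞) (fun r => (Real.sinh (k * r))⁻¹) (Set.Ioi 0) := by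
    intro k hk
    apply ContDiffOn.inv
    · exact (Real.contDiff_sinh.comp (contDiff_const.mul contDiff_id)).contDiffOn
    · intro x hx
      exact (sinh_pos' hk hx).ne'
  exact ((key 1 (by norm_num)).pow p).mul ((key (1 / 2) le_rfl).pow q)

end Aux16

open Aux16 in
theorem stmt16 (p q : ℕ) (hp : 1 ≤ p) (hq : 1 ≤ q) :
    ∃ γ : Fin (p + q) → ℝ → ℝ,
      (∀ j : Fin (p + q), ContDiffOn ℝ (⊤ : ℕ∞) (γ j) (Set.Ioi 0)) ∧
      (∃ C : ℝ, 0 ≤ C ∧ ∀ j : Fin (p + q), ∀ r : ℝ, 1 ≤ r →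
        |γ j r| ≤ C * Real.exp (-((p : ℝ) + (q : ℝ) / 2) * r)) ∧
      ∀ f : ℝ → ℂ, ContDiffOn ℝ (⊤ : ℕ∞) f (Set.Ioi 0) → ∀ r : ℝ, 0 < r →
        D1c^[p] (D2c^[q] f) r =
          ∑ j : Fin (p + q), (γ j r : ℂ) * iteratedDeriv (j.val + 1) f r := by
  have hrep : Rep (W p q) (p + q) (fun f => D1c^[p] (D2c^[q] f)) := by
    obtain ⟨q, rfl⟩ : ∃ m, q = m + 1 := ⟨q - 1, by omega⟩
    exact rep1 q p
  obtain ⟨β, hβ, hT⟩ := hrep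
  choose C hC hb using fun j => (hβ j).bdd
  refine ⟨fun j r => W p q r * β j r, fun j => (W_smooth p q).mul (hβ j).contDiffOn,
    ⟨4 ^ p * 4 ^ q * ∑ j : Fin (p + q), C j, ?_, fun j r hr => ?_⟩, fun f hf r hr => ?_⟩
  · exact mul_nonneg (by positivity) (Finset.sum_nonneg fun j _ => hC j)
  · have h1 : C j ≤ ∑ j : Fin (p + q), C j :=
      Finset.single_le_sum (f := fun j : Fin (p + q) => C j) (fun i _ => hC i)
        (Finset.mem_univ j)
    rw [abs_mul, mul_right_comm]
    exact mul_le_mul (W_bound p q r hr) ((hb j r hr).trans h1) (abs_nonneg _) (by positivity)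
  · refine (hT f hf r hr).trans ?_
    exact Finset.sum_range (fun j => ((W p q r * β j r : ℝ) : ℂ) * iteratedDeriv (j + 1) f r)
end
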